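/- Under the hypotheses of the sequential update scheme (F : ℝ^K → ℝ is C² with |∂²F/∂xᵢ∂xⱼ| ≤ β; updates cycle through a fixed list (ẽ₁, …, ẽ_K̃) of standard basis vectors containing every eᵢ; x^{n+1} − x^n is a multiple of ẽ_{n+1} with ‖x^{n+1} − x^n‖ ≤ γ·|∂ₙF(x^n)|; each step satisfies F(x^{n+1}) − F(x^n) ≥ μ·|∂ₙF(x^n)|² with μ > 0), for every n the primary descent condition holds: F(x^{n+K̃}) − F(x^n) ≥ (μ/(K̃·σ·γ)) · ‖dF(x^n)‖₁ · ‖x^{n+K̃} − x^n‖₁, where σ = 1 + (K−1)·β·γ and ‖·‖₁ denotes the ℓ¹ norm on ℝ^K. -/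

import Mathlib

open Finset

lemma abs_sub_le_of_partial_bound {K : ℕ} {G : (Fin K → ℝ) → ℝ} (hG : Differentiable ℝ G)
    {β : ℝ} {j : Fin K} (hb : ∀ y, |fderiv ℝ G y (Pi.single j 1 : Fin K → ℝ)| ≤ β)
    (y : Fin K → ℝ) (c : ℝ) :
    |G (y + c • (Pi.single j 1 : Fin K → ℝ)) - G y| ≤ β * |c| := by
  set v : Fin K → ℝ := Pi.single j 1
  have hderiv (t : ℝ) :
      HasDerivAt (fun s : ℝ => G (y + s • v)) (fderiv ℝ G (y + t • v) v) t := by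
    have hline : HasDerivAt (fun s : ℝ => y + s • v) v t := by
      simpa using ((hasDerivAt_id t).smul_const v).const_add y
    exact (hG _).hasFDerivAt.comp_hasDerivAt t hline
  simpa using Convex.norm_image_sub_le_of_norm_hasDerivWithin_le
    (fun t _ => (hderiv t).hasDerivWithinAt) (fun t _ => hb _) convex_univ
    (Set.mem_univ (0 : ℝ)) (Set.mem_univ c)

lemma exists_lt_apply_add_eq_of_periodic {α : Type*} {e : ℕ → α} {T : ℕ} (hT : 0 < T)
    (he : Function.Periodic e T) (he_surj : Function.Surjective e) (n : ℕ) (a : α) :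
    ∃ k, k < T ∧ e (n + k) = a := by
  obtain ⟨m, rfl⟩ := he_surj a
  refine ⟨(m + n * (T - 1)) % T, Nat.mod_lt _ hT, ?_⟩
  rw [← he.map_mod_nat, ← he.map_mod_nat m, Nat.add_mod_mod]
  obtain ⟨s, rfl⟩ : ∃ s, T = s + 1 := ⟨T - 1, by omega⟩
  rw [show n + (m + n * (s + 1 - 1)) = m + n * (s + 1) by
    rw [Nat.add_sub_cancel]; ring, Nat.add_mul_mod_self_right]

/-- Summing over all labels `i` the value of `a` at the first occurrence of `i`, plus `b` times
the values of `a` before that occurrence. -/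
lemma sum_first_occurrence_le {K T : ℕ} {f : ℕ → Fin K} {k : Fin K → ℕ}
    (hkT : ∀ i, k i < T) (hfk : ∀ i, f (k i) = i) (hmin : ∀ j, k (f j) ≤ j)
    {a : ℕ → ℝ} (ha : ∀ j, 0 ≤ a j) {b : ℝ} (hb : 0 ≤ b) :
    ∑ i, (a (k i) + ∑ j ∈ range (k i), b * a j) ≤
      (1 + ((K : ℝ) - 1) * b) * ∑ j ∈ range T, a j := by
  have hfirst : ∑ i, a (k i) ≤ ∑ j ∈ range T, a j := by
    rw [← sum_image (f := a) (Function.LeftInverse.injective hfk).injOn]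
    exact sum_le_sum_of_subset_of_nonneg
      (by intro j hj; obtain ⟨i, -, rfl⟩ := mem_image.1 hj; exact mem_range.2 (hkT i))
      (fun j _ _ => ha j)
  have hbefore : ∑ i, ∑ j ∈ range (k i), b * a j ≤
      ∑ j ∈ range T, ((K : ℝ) - 1) * (b * a j) := by
    rw [sum_comm' (t' := range T) (s' := fun j => univ.filter fun i => j < k i)
      (by intro i j; simp only [mem_univ, mem_range, mem_filter, true_and]
          exact ⟨fun h => ⟨h, h.trans (hkT i)⟩, fun h => h.1⟩)]
    refine sum_le_sum fun j _ => ?_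
    rw [sum_const, nsmul_eq_mul]
    refine mul_le_mul_of_nonneg_right ?_ (mul_nonneg hb (ha j))
    have hcard : #(univ.filter fun i => j < k i) < K := by
      simpa using card_lt_card (filter_ssubset (s := univ) (p := fun i => j < k i)
        |>.2 ⟨f j, mem_univ _, (hmin j).not_gt⟩)
    have : ((#(univ.filter fun i => j < k i) : ℕ) : ℝ) + 1 ≤ K := by exact_mod_cast hcard
    linarith
  rw [sum_add_distrib]
  simp only [← mul_sum] at hbefore ⊢
  linarith


/-- Under the sequential update scheme hypotheses (`F` C² with second partials
bounded by `β`; directions cycling with period `K̃` through every coordinate; one-coordinate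
steps with `‖xⁿ⁺¹ − xⁿ‖ ≤ γ·|∂ₙF(xⁿ)|`; per-step increase `F(xⁿ⁺¹) − F(xⁿ) ≥ μ·|∂ₙF(xⁿ)|²`
with `μ > 0`), the primary descent condition holds for every `n`:
`F(x^{n+K̃}) − F(xⁿ) ≥ (μ/(K̃·σ·γ)) · ‖dF(xⁿ)‖₁ · ‖x^{n+K̃} − xⁿ‖₁` with
`σ = 1 + (K−1)·β·γ`. -/
theorem sequential_update_primary_descent_condition
    (K Ktil : ℕ) (hKtil : 0 < Ktil) (F : (Fin K → ℝ) → ℝ) (β μ γ : ℝ)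
    (hμ : 0 < μ) (hγ : 0 < γ)
    (hF : ContDiff ℝ 2 F)
    (hbound : ∀ (x : Fin K → ℝ) (i j : Fin K),
      |fderiv ℝ (fun y => fderiv ℝ F y (Pi.single j 1 : Fin K → ℝ)) x
        (Pi.single i 1 : Fin K → ℝ)| ≤ β)
    (e : ℕ → Fin K) (he_per : Function.Periodic e Ktil)
    (he_surj : Function.Surjective e)
    (x : ℕ → Fin K → ℝ)
    (hdir : ∀ n, ∃ c : ℝ, x (n + 1) - x n = c • (Pi.single (e n) 1 : Fin K → ℝ))
    (hinc : ∀ n, F (x (n + 1)) - F (x n) ≥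
      μ * (fderiv ℝ F (x n) (Pi.single (e n) 1 : Fin K → ℝ)) ^ 2)
    (hlen : ∀ n, ‖x (n + 1) - x n‖ ≤
      γ * |fderiv ℝ F (x n) (Pi.single (e n) 1 : Fin K → ℝ)|) :
    ∀ n : ℕ,
      F (x (n + Ktil)) - F (x n) ≥
        (μ / (Ktil * (1 + ((K : ℝ) - 1) * β * γ) * γ)) *
          (∑ i : Fin K, |fderiv ℝ F (x n) (Pi.single i 1 : Fin K → ℝ)|) *
          (∑ i : Fin K, |x (n + Ktil) i - x n i|) := by
  intro n
  set v : Fin K → Fin K → ℝ := fun i => Pi.single i 1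
  set d : Fin K → (Fin K → ℝ) → ℝ := fun i y => fderiv ℝ F y (v i)
  set a : ℕ → ℝ := fun j => |d (e (n + j)) (x (n + j))|
  set σ : ℝ := 1 + ((K : ℝ) - 1) * β * γ
  have ha (j : ℕ) : 0 ≤ a j := abs_nonneg _
  have hβ : 0 ≤ β := (abs_nonneg _).trans (hbound 0 (e 0) (e 0))
  have hK : (1 : ℝ) ≤ K := by exact_mod_cast (e 0).pos
  have hσ : 0 < σ := by
    have : 0 ≤ ((K : ℝ) - 1) * β * γ := mul_nonneg (mul_nonneg (by linarith) hβ) hγ.le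
    linarith
  have hT : (0 : ℝ) < Ktil := by exact_mod_cast hKtil
  have hd (i : Fin K) : Differentiable ℝ (d i) :=
    ((hF.fderiv_right (m := 1) (by norm_num)).clm_apply contDiff_const).differentiable
      (by norm_num)
  have hstep (j : ℕ) : ∃ c : ℝ, x (n + (j + 1)) = x (n + j) + c • v (e (n + j)) ∧
      |c| ≤ γ * a j := by
    obtain ⟨c, hc⟩ := hdir (n + j)
    refine ⟨c, by rw [← hc, ← add_assoc]; abel, ?_⟩
    have h := hlen (n + j)
    rwa [hc, norm_smul, Pi.norm_single, norm_one, mul_one] at h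
  have hpartial (i : Fin K) (m : ℕ) :
      |d i (x n)| ≤ |d i (x (n + m))| + ∑ j ∈ range m, β * γ * a j := by
    induction m with
    | zero => simp
    | succ m ih =>
      obtain ⟨c, hc, hca⟩ := hstep m
      have h := abs_sub_le_of_partial_bound (hd i) (fun y => hbound y (e (n + m)) i)
        (x (n + m)) c
      rw [← hc, abs_sub_comm] at h
      have h₂ := abs_sub_abs_le_abs_sub (d i (x (n + m))) (d i (x (n + (m + 1))))
      have h₃ := mul_le_mul_of_nonneg_left hca hβ
      rw [sum_range_succ]
      linarith
  have hgrad : ∑ i, |d i (x n)| ≤ σ * ∑ j ∈ range Ktil, a j := by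
    classical
    have hex (i : Fin K) : ∃ k, e (n + k) = i :=
      (exists_lt_apply_add_eq_of_periodic hKtil he_per he_surj n i).imp fun _ h => h.2
    have hspec (i : Fin K) : e (n + Nat.find (hex i)) = i := Nat.find_spec (hex i)
    calc ∑ i, |d i (x n)|
        ≤ ∑ i, (a (Nat.find (hex i)) + ∑ j ∈ range (Nat.find (hex i)), β * γ * a j) := by
          refine sum_le_sum fun i _ => (hpartial i (Nat.find (hex i))).trans_eq ?_
          simp only [a, hspec]
      _ ≤ (1 + ((K : ℝ) - 1) * (β * γ)) * ∑ j ∈ range Ktil, a j :=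
          sum_first_occurrence_le (f := fun j => e (n + j))
            (fun i => by
              obtain ⟨k, hk, hki⟩ :=
                exists_lt_apply_add_eq_of_periodic hKtil he_per he_surj n i
              exact (Nat.find_min' (hex i) hki).trans_lt hk)
            hspec (fun j => Nat.find_min' _ rfl) ha (mul_nonneg hβ hγ.le)
      _ = σ * ∑ j ∈ range Ktil, a j := by simp only [σ, mul_assoc]
  have hdist (m : ℕ) : ∑ i, |x (n + m) i - x n i| ≤ γ * ∑ j ∈ range m, a j := by
    induction m with
    | zero => simp
    | succ m ih =>
      obtain ⟨c, hc, hca⟩ := hstep m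
      have hsingle : ∑ i, |c * v (e (n + m)) i| = |c| := by
        rw [sum_eq_single (e (n + m))]
        · simp [v]
        · intro i _ hi
          simp [v, hi]
        · simp
      have h : ∑ i, |x (n + (m + 1)) i - x n i| ≤
          ∑ i, (|x (n + m) i - x n i| + |c * v (e (n + m)) i|) := by
        refine sum_le_sum fun i _ => ?_
        rw [hc, Pi.add_apply, Pi.smul_apply, smul_eq_mul, add_sub_right_comm]
        exact abs_add_le _ _
      rw [sum_add_distrib, hsingle] at h
      rw [sum_range_succ, mul_add]
      linarith
  have hincr (m : ℕ) : μ * ∑ j ∈ range m, a j ^ 2 ≤ F (x (n + m)) - F (x n) := by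
    induction m with
    | zero => simp
    | succ m ih =>
      have h : F (x (n + (m + 1))) - F (x (n + m)) ≥ μ * d (e (n + m)) (x (n + m)) ^ 2 :=
        hinc (n + m)
      rw [sum_range_succ, mul_add, show a m ^ 2 = d (e (n + m)) (x (n + m)) ^ 2 from sq_abs _]
      linarith
  have hcs : (∑ j ∈ range Ktil, a j) ^ 2 ≤ Ktil * ∑ j ∈ range Ktil, a j ^ 2 := by
    simpa using sq_sum_le_card_mul_sum_sq (s := range Ktil) (f := a)
  have hsum : 0 ≤ ∑ j ∈ range Ktil, a j := sum_nonneg fun j _ => ha j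
  change _ * (∑ i, |d i (x n)|) * _ ≤ _
  calc μ / (Ktil * σ * γ) * (∑ i, |d i (x n)|) * ∑ i, |x (n + Ktil) i - x n i|
      ≤ μ / (Ktil * σ * γ) * (σ * ∑ j ∈ range Ktil, a j) * (γ * ∑ j ∈ range Ktil, a j) := by
        gcongr
        exact hdist Ktil
    _ = μ / Ktil * (∑ j ∈ range Ktil, a j) ^ 2 := by field_simp
    _ ≤ μ / Ktil * (Ktil * ∑ j ∈ range Ktil, a j ^ 2) := by gcongr
    _ = μ * ∑ j ∈ range Ktil, a j ^ 2 := by field_simp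
    _ ≤ F (x (n + Ktil)) - F (x n) := hincr Ktil
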